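/- Fix n ≥ 2. For each s ≥ 1, let P_1, …, P_s be independent Kostlan random homogeneous polynomials of degree 2 in n+1 variables, let Γ_i = Z(P_i) ⊆ ℝP^n and Γ_s = Γ_1 ∪ ⋯ ∪ Γ_s. Then E[b_0(Γ_s)]/s → 0 as s → ∞. -/

import Mathlib

open MeasureTheory ProbabilityTheory

noncomputable section

/-- The index set of monomials of degree `d` in the `n+1` variables `x_0, …, x_n`:
exponent vectors `α` (each exponent is at most `d`) with `α_0 + ⋯ + α_n = d`. -/
abbrev MonIdx (n d : ℕ) : Type := {α : Fin (n + 1) → Fin (d + 1) // ∑ i, (α i : ℕ) = d}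

/-- Evaluation at `x ∈ ℝ^{n+1}` of the homogeneous polynomial of degree `d` with
coefficient vector `c`, namely `Σ_α c_α x_0^{α_0} ⋯ x_n^{α_n}`. -/
def mEval {n d : ℕ} (c : MonIdx n d → ℝ) (x : Fin (n + 1) → ℝ) : ℝ :=
  ∑ α : MonIdx n d, c α * ∏ i, x i ^ (α.1 i : ℕ)

/-- The Kostlan distribution on the space of (coefficient vectors of) homogeneous
polynomials of degree `d` in `n+1` variables: the coefficients `ξ_α` are independent
centered Gaussians with variance the multinomial coefficient `d!/(α_0! ⋯ α_n!)`. -/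
def kostlanMeasure (n d : ℕ) : Measure (MonIdx n d → ℝ) :=
  Measure.pi fun α => gaussianReal 0 (Nat.multinomial Finset.univ fun i => (α.1 i : ℕ))

instance (n d : ℕ) : IsProbabilityMeasure (kostlanMeasure n d) := by
  unfold kostlanMeasure; infer_instance

/-- The quotient topology on a projectivization. -/
instance {K V : Type*} [DivisionRing K] [AddCommGroup V] [Module K V] [TopologicalSpace V] :
    TopologicalSpace (Projectivization K V) :=
  instTopologicalSpaceQuotient

/-- The zero set in `ℝP^n` of the homogeneous polynomial with coefficients `c`. -/
def zeroSet {n d : ℕ} (c : MonIdx n d → ℝ) : Set (Projectivization ℝ (Fin (n + 1) → ℝ)) :=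
  {p | mEval c p.rep = 0}

/-- The number of connected components of a topological space. -/
def b₀ (X : Type*) [TopologicalSpace X] : ℕ := Nat.card (ConnectedComponents X)

open Filter Topology Set
open scoped ENNReal NNReal

section Algebra

variable {n d : ℕ}

lemma mEval_add (c c' : MonIdx n d → ℝ) (x : Fin (n + 1) → ℝ) :
    mEval (c + c') x = mEval c x + mEval c' x := by
  simp [mEval, add_mul, Finset.sum_add_distrib]

lemma mEval_const_smul (a : ℝ) (c : MonIdx n d → ℝ) (x : Fin (n + 1) → ℝ) :
    mEval (a • c) x = a * mEval c x := by
  simp [mEval, Finset.mul_sum, mul_assoc]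

lemma mEval_smul (c : MonIdx n d → ℝ) (a : ℝ) (x : Fin (n + 1) → ℝ) :
    mEval c (a • x) = a ^ d * mEval c x := by
  unfold mEval
  rw [Finset.mul_sum]
  refine Finset.sum_congr rfl fun α _ => ?_
  simp only [Pi.smul_apply, smul_eq_mul, mul_pow, Finset.prod_mul_distrib]
  rw [Finset.prod_pow_eq_pow_sum, α.2]
  ring

@[fun_prop]
lemma continuous_mEval : Continuous fun z : (MonIdx n d → ℝ) × (Fin (n + 1) → ℝ) =>
    mEval z.1 z.2 := by
  unfold mEval
  fun_prop

lemma exists_prod_pow_eq_mul {ι : Type*} [Fintype ι] [DecidableEq ι] (f : ι → ℕ) {k : ℕ}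
    (hf : ∑ i, f i = k + 1) :
    ∃ i, ∃ g : ι → ℕ, ∑ i, g i = k ∧ ∀ x : ι → ℝ, ∏ j, x j ^ f j = x i * ∏ j, x j ^ g j := by
  obtain ⟨i, hi⟩ : ∃ i, f i ≠ 0 := by
    by_contra! h
    simp [h] at hf
  have hfg : f = (f - Pi.single i 1) + Pi.single i 1 := by
    ext j
    by_cases h : j = i
    · subst h
      simp
      omega
    · simp [h]
  refine ⟨i, f - Pi.single i 1, ?_, fun x => ?_⟩
  · rw [hfg] at hf
    simp only [Pi.add_apply, Finset.sum_add_distrib, Finset.sum_pi_single', Finset.mem_univ,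
      if_true] at hf
    simpa using hf
  · conv_lhs => rw [hfg]
    simp only [Pi.add_apply, pow_add, Finset.prod_mul_distrib]
    rw [mul_comm]
    congr 1
    simp [Pi.single_apply, pow_ite]

lemma exists_monomial_eq_mul (α : MonIdx n 2) :
    ∃ i j, ∀ x : Fin (n + 1) → ℝ, ∏ k, x k ^ (α.1 k : ℕ) = x i * x j := by
  obtain ⟨i, g, hg, h⟩ := exists_prod_pow_eq_mul (fun k => (α.1 k : ℕ)) α.2
  obtain ⟨j, g', hg', h'⟩ := exists_prod_pow_eq_mul g hg
  refine ⟨i, j, fun x => ?_⟩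
  have : ∀ k, g' k = 0 := by simpa using hg'
  simp [h, h', this]

lemma exists_polar (c : MonIdx n 2 → ℝ) :
    ∃ B : (Fin (n + 1) → ℝ) →ₗ[ℝ] (Fin (n + 1) → ℝ) →ₗ[ℝ] ℝ,
      (∀ x y, mEval c (x + y) = mEval c x + B x y + mEval c y) ∧ (∀ x y, B x y = B y x) ∧
      ∀ x, B x x = 2 * mEval c x := by
  choose i j hij using fun α : MonIdx n 2 => exists_monomial_eq_mul α
  refine ⟨LinearMap.mk₂ ℝ (fun x y => ∑ α, c α * (x (i α) * y (j α) + y (i α) * x (j α)))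
    ?_ ?_ ?_ ?_, ?_, ?_, ?_⟩
  · intro x y z
    rw [← Finset.sum_add_distrib]
    exact Finset.sum_congr rfl fun α _ => by simp; ring
  · intro a x y
    rw [smul_eq_mul, Finset.mul_sum]
    exact Finset.sum_congr rfl fun α _ => by simp; ring
  · intro x y z
    rw [← Finset.sum_add_distrib]
    exact Finset.sum_congr rfl fun α _ => by simp; ring
  · intro a x y
    rw [smul_eq_mul, Finset.mul_sum]
    exact Finset.sum_congr rfl fun α _ => by simp; ring
  · intro x y
    simp only [mEval, hij, LinearMap.mk₂_apply]
    rw [← Finset.sum_add_distrib, ← Finset.sum_add_distrib]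
    exact Finset.sum_congr rfl fun α _ => by simp; ring
  · intro x y
    simp only [LinearMap.mk₂_apply]
    exact Finset.sum_congr rfl fun α _ => by ring
  · intro x
    simp only [mEval, hij, LinearMap.mk₂_apply]
    rw [Finset.mul_sum]
    exact Finset.sum_congr rfl fun α _ => by ring

lemma exists_mEval_eq_mul (i j : Fin (n + 1)) :
    ∃ c : MonIdx n 2 → ℝ, ∀ x, mEval c x = x i * x j := by
  classical
  let f : Fin (n + 1) → ℕ := Pi.single i 1 + Pi.single j 1
  have hf : ∑ k, f k = 2 := by simp [f, Finset.sum_add_distrib]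
  have hlt : ∀ k, f k < 3 := fun k => by
    have := Finset.single_le_sum (f := f) (fun _ _ => Nat.zero_le _) (Finset.mem_univ k)
    omega
  let α : MonIdx n 2 := ⟨fun k => ⟨f k, hlt k⟩, by simpa using hf⟩
  refine ⟨Pi.single α 1, fun x => ?_⟩
  unfold mEval
  rw [Finset.sum_eq_single α (fun β _ hβ => by simp [hβ]) (by simp)]
  have hα : ∀ k, (α.1 k : ℕ) =
      (Pi.single i 1 : Fin (n + 1) → ℕ) k + (Pi.single j 1 : Fin (n + 1) → ℕ) k := fun _ => rfl
  have hs : ∀ l : Fin (n + 1), ∏ k, x k ^ (Pi.single l 1 : Fin (n + 1) → ℕ) k = x l := fun l => by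
    simp [Pi.single_apply, pow_ite]
  simp only [hα, pow_add, Finset.prod_mul_distrib, hs, Pi.single_eq_same, one_mul]

/-- The square of a linear form in two coordinates is a quadratic form. -/
lemma exists_mEval_eq_sq (i j : Fin (n + 1)) (a b : ℝ) :
    ∃ c : MonIdx n 2 → ℝ, ∀ x, mEval c x = (a * x i - b * x j) ^ 2 := by
  obtain ⟨c₁, h₁⟩ := exists_mEval_eq_mul i i
  obtain ⟨c₂, h₂⟩ := exists_mEval_eq_mul i j
  obtain ⟨c₃, h₃⟩ := exists_mEval_eq_mul j j
  refine ⟨a ^ 2 • c₁ + (-2 * a * b) • c₂ + b ^ 2 • c₃, fun x => ?_⟩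
  simp only [mEval_add, mEval_const_smul, h₁, h₂, h₃]
  ring

lemma exists_mEval_eq_sum_sq (n : ℕ) :
    ∃ c : MonIdx n 2 → ℝ, ∀ x, mEval c x = ∑ i, x i ^ 2 := by
  choose c hc using fun i : Fin (n + 1) => exists_mEval_eq_mul i i
  refine ⟨∑ i, c i, fun x => ?_⟩
  have : ∀ s : Finset (Fin (n + 1)), mEval (∑ i ∈ s, c i) x = ∑ i ∈ s, x i ^ 2 := by
    intro s
    induction s using Finset.induction_on with
    | empty => simp [mEval]
    | insert i s hi ih => rw [Finset.sum_insert hi, Finset.sum_insert hi, mEval_add, hc, ih, sq]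
  exact this _

/-- Two points at which some quadratic form takes opposite signs have a nonzero minor. -/
lemma exists_minor_ne_zero {c : MonIdx n 2 → ℝ} {a b : Fin (n + 1) → ℝ}
    (ha : 0 < mEval c a) (hb : mEval c b < 0) : ∃ i j, a i * b j - a j * b i ≠ 0 := by
  by_contra! h
  obtain ⟨j, hj⟩ : ∃ j, b j ≠ 0 := by
    by_contra! h0
    have : b = (0 : ℝ) • b := by ext i; simp [h0]
    rw [this, mEval_smul] at hb
    simp at hb
  have hab : b j • a = a j • b := by
    ext i
    have := h i j
    simp only [Pi.smul_apply, smul_eq_mul]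
    linarith
  have := congrArg (mEval c) hab
  rw [mEval_smul, mEval_smul] at this
  nlinarith [sq_nonneg (a j), mul_pos (pow_pos (abs_pos.2 hj) 2) ha, sq_abs (b j)]

end Algebra

section Geometry

variable {n : ℕ}

lemma eventually_mEval_pos {K : Set (Fin (n + 1) → ℝ)} (hK : IsCompact K)
    {c : MonIdx n 2 → ℝ} (h : ∀ x ∈ K, 0 < mEval c x) :
    ∀ᶠ c' in 𝓝 c, ∀ x ∈ K, 0 < mEval c' x :=
  hK.eventually_forall_of_forall_eventually (P := fun c x => 0 < mEval c x) fun y hy =>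
    (continuous_mEval.tendsto (c, y)).eventually (lt_mem_nhds (h y hy))

lemma eventually_mEval_neg {K : Set (Fin (n + 1) → ℝ)} (hK : IsCompact K)
    {c : MonIdx n 2 → ℝ} (h : ∀ x ∈ K, mEval c x < 0) :
    ∀ᶠ c' in 𝓝 c, ∀ x ∈ K, mEval c' x < 0 :=
  hK.eventually_forall_of_forall_eventually (P := fun c x => mEval c x < 0) fun y hy =>
    (continuous_mEval.tendsto (c, y)).eventually (gt_mem_nhds (h y hy))

lemma exists_mEval_rep_mk (v : Fin (n + 1) → ℝ) (hv : v ≠ 0) :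
    ∃ r : ℝ, 0 < r ∧ ∀ c : MonIdx n 2 → ℝ,
      mEval c (Projectivization.mk ℝ v hv).rep = r * mEval c v := by
  obtain ⟨a, ha⟩ := Projectivization.exists_smul_eq_mk_rep ℝ v hv
  refine ⟨(a : ℝ) ^ 2, by have := a.ne_zero; positivity, fun c => ?_⟩
  rw [← ha, ← mEval_smul]
  rfl

lemma mk_mem_zeroSet {c : MonIdx n 2 → ℝ} {v : Fin (n + 1) → ℝ} (hv : v ≠ 0) :
    Projectivization.mk ℝ v hv ∈ zeroSet c ↔ mEval c v = 0 := by
  obtain ⟨r, hr, h⟩ := exists_mEval_rep_mk v hv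
  simp [zeroSet, h, hr.ne']

lemma mEval_rep_mk_pos {c : MonIdx n 2 → ℝ} {v : Fin (n + 1) → ℝ} (hv : v ≠ 0) :
    0 < mEval c (Projectivization.mk ℝ v hv).rep ↔ 0 < mEval c v := by
  obtain ⟨r, hr, h⟩ := exists_mEval_rep_mk v hv
  simp [h, hr]

lemma continuous_projectivization_mk {X : Type*} [TopologicalSpace X] {f : X → Fin (n + 1) → ℝ}
    (hf : Continuous f) (h0 : ∀ x, f x ≠ 0) :
    Continuous fun x => Projectivization.mk ℝ (f x) (h0 x) :=
  continuous_quotient_mk'.comp (hf.subtype_mk h0)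

lemma isOpen_mEval_rep_pos (c : MonIdx n 2 → ℝ) :
    IsOpen {p : Projectivization ℝ (Fin (n + 1) → ℝ) | 0 < mEval c p.rep} := by
  refine isQuotientMap_quotient_mk'.isOpen_preimage.1 ?_
  have : IsOpen {v : {v : Fin (n + 1) → ℝ // v ≠ 0} | 0 < mEval c v.1} :=
    isOpen_lt continuous_const (by fun_prop)
  convert this using 1
  ext v
  exact mEval_rep_mk_pos v.2

lemma mEval_neg_left (c : MonIdx n 2 → ℝ) (x : Fin (n + 1) → ℝ) :
    mEval (-c) x = -mEval c x := by
  simp [mEval]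

lemma isOpen_mEval_rep_neg (c : MonIdx n 2 → ℝ) :
    IsOpen {p : Projectivization ℝ (Fin (n + 1) → ℝ) | mEval c p.rep < 0} := by
  simpa [mEval_neg_left] using isOpen_mEval_rep_pos (-c)

/-- Two points of the zero set lie in a common preconnected subset of it. -/
def ZeroJoined (c : MonIdx n 2 → ℝ) (p q : Projectivization ℝ (Fin (n + 1) → ℝ)) : Prop :=
  ∃ T ⊆ zeroSet c, p ∈ T ∧ q ∈ T ∧ IsPreconnected T

lemma ZeroJoined.trans {c : MonIdx n 2 → ℝ} {p q r : Projectivization ℝ (Fin (n + 1) → ℝ)}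
    (h : ZeroJoined c p q) (h' : ZeroJoined c q r) : ZeroJoined c p r := by
  obtain ⟨T, hT, hp, hq, hc⟩ := h
  obtain ⟨T', hT', hq', hr, hc'⟩ := h'
  exact ⟨T ∪ T', union_subset hT hT', Or.inl hp, Or.inr hr, hc.union q hq hq' hc'⟩

lemma zeroJoined_of_path {c : MonIdx n 2 → ℝ} {γ : ℝ → Fin (n + 1) → ℝ} (hγ : Continuous γ)
    (h0 : ∀ t ∈ Icc (0 : ℝ) 1, γ t ≠ 0) (hz : ∀ t ∈ Icc (0 : ℝ) 1, mEval c (γ t) = 0)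
    {x y : Fin (n + 1) → ℝ} (hx : x ≠ 0) (hy : y ≠ 0) (hγx : γ 0 = x) (hγy : γ 1 = y) :
    ZeroJoined c (.mk ℝ x hx) (.mk ℝ y hy) := by
  subst hγx hγy
  let f : Icc (0 : ℝ) 1 → Projectivization ℝ (Fin (n + 1) → ℝ) := fun t =>
    .mk ℝ (γ t) (h0 t t.2)
  have hf : Continuous f := continuous_projectivization_mk (by fun_prop) _
  refine ⟨range f, ?_, ⟨⟨0, by simp⟩, rfl⟩, ⟨⟨1, by simp⟩, rfl⟩, isPreconnected_range hf⟩
  rintro _ ⟨t, rfl⟩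
  exact (mk_mem_zeroSet _).2 (hz t t.2)

lemma mk_neg_eq {x : Fin (n + 1) → ℝ} (hx : x ≠ 0) :
    Projectivization.mk ℝ (-x) (neg_ne_zero.2 hx) = Projectivization.mk ℝ x hx :=
  (Projectivization.mk_eq_mk_iff' _ _ _ _ _).2 ⟨-1, by simp⟩

lemma zeroJoined_of_polar_eq_zero {c : MonIdx n 2 → ℝ} {x y : Fin (n + 1) → ℝ}
    (hx : x ≠ 0) (hy : y ≠ 0) (hcx : mEval c x = 0) (hcy : mEval c y = 0)
    (hxy : mEval c (x + y) = 0) : ZeroJoined c (.mk ℝ x hx) (.mk ℝ y hy) := by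
  by_cases hne : Projectivization.mk ℝ x hx = Projectivization.mk ℝ y hy
  · rw [hne]
    exact ⟨{.mk ℝ y hy}, by simpa using (mk_mem_zeroSet hy).2 hcy, rfl, rfl,
      isPreconnected_singleton⟩
  obtain ⟨B, hB, -, -⟩ := exists_polar c
  have hBxy : B x y = 0 := by
    have := hB x y
    linarith
  refine zeroJoined_of_path (γ := fun t => (1 - t) • x + t • y) (by fun_prop) ?_ ?_ hx hy
    (by simp) (by simp)
  · rintro t - h
    refine hne ((Projectivization.mk_eq_mk_iff' _ _ _ _ _).2 ?_)
    by_cases ht : 1 - t = 0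
    · rw [ht, zero_smul, zero_add, show t = 1 by linarith, one_smul] at h
      exact absurd h hy
    · refine ⟨-(t / (1 - t)), ?_⟩
      have hty : t • y = -((1 - t) • x) := eq_neg_of_add_eq_zero_right h
      rw [neg_smul, div_eq_inv_mul, mul_smul, hty, smul_neg, neg_neg, inv_smul_smul₀ ht]
  · intro t _
    rw [hB, mEval_smul, mEval_smul, hcx, hcy]
    simp [hBxy]

lemma zeroJoined_of_polar_mul_neg {c : MonIdx n 2 → ℝ}
    {B : (Fin (n + 1) → ℝ) →ₗ[ℝ] (Fin (n + 1) → ℝ) →ₗ[ℝ] ℝ}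
    (hB : ∀ x y, mEval c (x + y) = mEval c x + B x y + mEval c y) (hsymm : ∀ x y, B x y = B y x)
    (hdiag : ∀ x, B x x = 2 * mEval c x) {x y z : Fin (n + 1) → ℝ} (hx : x ≠ 0) (hy : y ≠ 0)
    (hcx : mEval c x = 0) (hcy : mEval c y = 0) (hxz : B x z = 0) (hyz : B y z = 0)
    (hneg : B x y * mEval c z < 0) : ZeroJoined c (.mk ℝ x hx) (.mk ℝ y hy) := by
  have hz0 : mEval c z ≠ 0 := fun h => by simp [h] at hneg
  have hk0 : B x y ≠ 0 := fun h => by simp [h] at hneg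
  have hr : 0 ≤ -(B x y) / mEval c z := by
    rw [neg_div, neg_nonneg]
    rcases lt_or_gt_of_ne hz0 with h | h
    · exact div_nonpos_of_nonneg_of_nonpos (by nlinarith) h.le
    · exact div_nonpos_of_nonpos_of_nonneg (by nlinarith) h.le
  refine zeroJoined_of_path
    (γ := fun t => ((1 - t) • x + t • y) + √(t * (1 - t) * (-(B x y) / mEval c z)) • z)
    (by fun_prop) ?_ ?_ hx hy (by simp) (by simp)
  · rintro t - h
    have h1 := congrArg (B x) h
    have h2 := congrArg (B y) h
    simp [hxz, hyz, hdiag, hcx, hcy, hsymm y x, hk0] at h1 h2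
    linarith
  · rintro t ⟨h0, h1⟩
    have hs : 0 ≤ t * (1 - t) * (-(B x y) / mEval c z) :=
      mul_nonneg (mul_nonneg h0 (by linarith)) hr
    rw [hB, hB, mEval_smul, mEval_smul, mEval_smul, hcx, hcy, Real.sq_sqrt hs]
    simp [hxz, hyz]
    field_simp
    ring

/-- A real projective quadric of positive dimension is connected or empty. -/
lemma isPreconnected_zeroSet (hn : 2 ≤ n) (c : MonIdx n 2 → ℝ) : IsPreconnected (zeroSet c) := by
  refine isPreconnected_of_forall_pair fun p hp q hq => ?_
  suffices ZeroJoined c p q from this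
  induction p using Projectivization.ind with | h x hx => ?_
  induction q using Projectivization.ind with | h y hy => ?_
  rw [mk_mem_zeroSet] at hp hq
  obtain ⟨B, hB, hsymm, hdiag⟩ := exists_polar c
  by_cases hxy : B x y = 0
  · exact zeroJoined_of_polar_eq_zero hx hy hp hq (by rw [hB]; linarith)
  obtain ⟨z, hz, hz0⟩ := Submodule.exists_mem_ne_zero_of_ne_bot
    (LinearMap.ker_ne_bot_of_finrank_lt (f := (B x).prod (B y)) (by simp; omega))
  obtain ⟨hxz, hyz⟩ : B x z = 0 ∧ B y z = 0 := by simpa using hz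
  rcases lt_trichotomy (B x y * mEval c z) 0 with h | h | h
  · exact zeroJoined_of_polar_mul_neg hB hsymm hdiag hx hy hp hq hxz hyz h
  · have hcz : mEval c z = 0 := (mul_eq_zero.1 h).resolve_left hxy
    exact (zeroJoined_of_polar_eq_zero hx hz0 hp hcz (by rw [hB]; linarith)).trans
      (zeroJoined_of_polar_eq_zero hz0 hy hcz hq (by rw [hB, hsymm z y]; linarith))
  · rw [← mk_neg_eq hy]
    refine zeroJoined_of_polar_mul_neg hB hsymm hdiag hx _ hp ?_ hxz (by simpa using hyz)
      (by simpa using h)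
    rw [← neg_one_smul ℝ y, mEval_smul, hq, mul_zero]

/-- A connected zero set containing zeros at which `c'` has opposite signs meets that of `c'`. -/
lemma zeroSet_inter_nonempty (hn : 2 ≤ n) {c c' : MonIdx n 2 → ℝ} {x y : Fin (n + 1) → ℝ}
    (hcx : mEval c x = 0) (hcy : mEval c y = 0) (hx : 0 < mEval c' x) (hy : mEval c' y < 0) :
    (zeroSet c ∩ zeroSet c').Nonempty := by
  have hx0 : x ≠ 0 := by
    rintro rfl
    simpa using hx.ne' (by simpa using mEval_smul c' 0 0)
  have hy0 : y ≠ 0 := by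
    rintro rfl
    simpa using hy.ne (by simpa using mEval_smul c' 0 0)
  by_contra h
  rw [not_nonempty_iff_eq_empty] at h
  have hsub : zeroSet c ⊆ {p | 0 < mEval c' p.rep} ∪ {p | mEval c' p.rep < 0} := by
    intro p hp
    rcases lt_trichotomy (mEval c' p.rep) 0 with h' | h' | h'
    · exact Or.inr h'
    · exact absurd (show p ∈ zeroSet c ∩ zeroSet c' from ⟨hp, h'⟩) (by simp [h])
    · exact Or.inl h'
  obtain ⟨p, -, hp, hp'⟩ := isPreconnected_zeroSet hn c _ _ (isOpen_mEval_rep_pos c')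
    (isOpen_mEval_rep_neg c') hsub
    ⟨.mk ℝ x hx0, (mk_mem_zeroSet hx0).2 hcx, (mEval_rep_mk_pos hx0).2 hx⟩
    ⟨.mk ℝ y hy0, (mk_mem_zeroSet hy0).2 hcy, by
      simpa [mEval_neg_left] using (mEval_rep_mk_pos (c := -c') hy0).2 (by simpa [mEval_neg_left])⟩
  rw [mem_ofPred_eq] at hp hp'
  exact lt_asymm hp hp'

end Geometry

section Domination

variable {n : ℕ}

/-- All quadrics with coefficients near `c` are empty or meet every quadric with coefficients in a
common nonempty open set. -/
def LocallyDominated (c : MonIdx n 2 → ℝ) : Prop :=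
  ∃ U ∈ 𝓝 c, ∃ A : Set (MonIdx n 2 → ℝ), IsOpen A ∧ A.Nonempty ∧
    ∀ c₁ ∈ U, ∀ c' ∈ A, zeroSet c₁ = ∅ ∨ (zeroSet c₁ ∩ zeroSet c').Nonempty

lemma exists_sign_changing_roots {α β γ : ℝ} (hα : 0 < α) (hγ : γ < 0) :
    ∃ t₁ t₂ : ℝ, t₁ < t₂ ∧ ∀ t, α + t * β + t ^ 2 * γ = γ * (t - t₁) * (t - t₂) := by
  have hΔ : 0 < β ^ 2 - 4 * α * γ := by nlinarith [sq_nonneg β, mul_pos hα (neg_pos.2 hγ)]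
  have hs := Real.sqrt_pos.2 hΔ
  have hsq := Real.sq_sqrt hΔ.le
  set D := √(β ^ 2 - 4 * α * γ)
  refine ⟨(-β + D) / (2 * γ), (-β - D) / (2 * γ), ?_, fun t => ?_⟩
  · exact div_lt_div_of_neg_of_lt (by linarith) (by linarith)
  · have := hγ.ne
    field_simp
    linear_combination hsq

lemma exists_mEval_pos_neg {c : MonIdx n 2 → ℝ} {a b : Fin (n + 1) → ℝ}
    (ha : 0 < mEval c a) (hb : mEval c b < 0) {s t : ℝ} (hst : s ≠ t) :
    ∃ c' : MonIdx n 2 → ℝ, 0 < mEval c' (a + t • b) ∧ mEval c' (a + s • b) < 0 := by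
  obtain ⟨i, j, hij⟩ := exists_minor_ne_zero ha hb
  obtain ⟨c₁, h₁⟩ := exists_mEval_eq_sq i j ((a + s • b) j) ((a + s • b) i)
  obtain ⟨c₂, h₂⟩ := exists_mEval_eq_sq i j ((a + t • b) j) ((a + t • b) i)
  have hpos : 0 < ((t - s) * (a i * b j - a j * b i)) ^ 2 := by
    have := sub_ne_zero.2 hst.symm
    positivity
  refine ⟨c₁ + (-1 : ℝ) • c₂, ?_, ?_⟩ <;>
  · simp only [mEval_add, mEval_const_smul, h₁, h₂, Pi.add_apply, Pi.smul_apply, smul_eq_mul]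
    nlinarith

lemma locallyDominated_of_indefinite (hn : 2 ≤ n) {c : MonIdx n 2 → ℝ} {a b : Fin (n + 1) → ℝ}
    (ha : 0 < mEval c a) (hb : mEval c b < 0) : LocallyDominated c := by
  obtain ⟨B, hB, -, -⟩ := exists_polar c
  obtain ⟨t₁, t₂, ht, hroots⟩ := exists_sign_changing_roots (β := B a b) ha hb
  have hf : ∀ t : ℝ, mEval c (a + t • b) = mEval c b * (t - t₁) * (t - t₂) := fun t => by
    rw [← hroots, hB, mEval_smul, map_smul, smul_eq_mul]
  have hcont : ∀ c : MonIdx n 2 → ℝ, Continuous fun t : ℝ => mEval c (a + t • b) :=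
    fun c => by fun_prop
  have hcont' : ∀ x : Fin (n + 1) → ℝ, Continuous fun c : MonIdx n 2 → ℝ => mEval c x :=
    fun x => by fun_prop
  obtain ⟨c', hpos, hneg⟩ := exists_mEval_pos_neg ha hb ht.ne
  obtain ⟨δ₂, hδ₂, hsub₂⟩ := Metric.nhds_basis_closedBall.mem_iff.1
    ((hcont c').continuousAt.eventually (lt_mem_nhds hpos))
  obtain ⟨δ₁, hδ₁, hsub₁⟩ := Metric.nhds_basis_closedBall.mem_iff.1
    ((hcont c').continuousAt.eventually (gt_mem_nhds hneg))
  obtain ⟨δ, hδ, hδ'⟩ := exists_between (lt_min (lt_min hδ₁ hδ₂) (sub_pos.2 ht))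
  simp only [lt_min_iff] at hδ'
  obtain ⟨⟨h₁, h₂⟩, h₃⟩ := hδ'
  rw [Real.closedBall_eq_Icc] at hsub₁ hsub₂
  have hK : ∀ t : ℝ, IsCompact ((fun u : ℝ => a + u • b) '' Icc (t - δ) (t + δ)) := fun t =>
    isCompact_Icc.image (by fun_prop)
  have hA₂ := eventually_mEval_pos (hK t₂) (c := c') (forall_mem_image.2 fun u hu =>
    hsub₂ ⟨by linarith [hu.1], by linarith [hu.2]⟩)
  have hA₁ := eventually_mEval_neg (hK t₁) (c := c') (forall_mem_image.2 fun u hu =>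
    hsub₁ ⟨by linarith [hu.1], by linarith [hu.2]⟩)
  have hU₁ : mEval c (a + (t₁ - δ) • b) < 0 := by
    rw [hf]
    exact mul_neg_of_pos_of_neg (mul_pos_of_neg_of_neg hb (by linarith)) (by linarith)
  have hU₂ : 0 < mEval c (a + (t₁ + δ) • b) := by
    rw [hf]
    exact mul_pos_of_neg_of_neg (mul_neg_of_neg_of_pos hb (by linarith)) (by linarith)
  have hU₃ : 0 < mEval c (a + (t₂ - δ) • b) := by
    rw [hf]
    exact mul_pos_of_neg_of_neg (mul_neg_of_neg_of_pos hb (by linarith)) (by linarith)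
  have hU₄ : mEval c (a + (t₂ + δ) • b) < 0 := by
    rw [hf]
    exact mul_neg_of_neg_of_pos (mul_neg_of_neg_of_pos hb (by linarith)) (by linarith)
  refine ⟨_, ((((hcont' _).continuousAt.eventually (gt_mem_nhds hU₁)).and
    ((hcont' _).continuousAt.eventually (lt_mem_nhds hU₂))).and
    (((hcont' _).continuousAt.eventually (lt_mem_nhds hU₃)).and
    ((hcont' _).continuousAt.eventually (gt_mem_nhds hU₄)))), interior _, isOpen_interior,
    ⟨c', mem_interior_iff_mem_nhds.2 (hA₂.and hA₁)⟩, ?_⟩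
  rintro c₁ ⟨⟨hc₁, hc₂⟩, hc₃, hc₄⟩ d hd
  obtain ⟨hd₂, hd₁⟩ := interior_subset hd
  obtain ⟨u, hu, hu0⟩ := intermediate_value_Icc (by linarith : t₁ - δ ≤ t₁ + δ)
    (hcont c₁).continuousOn ⟨hc₁.le, hc₂.le⟩
  obtain ⟨v, hv, hv0⟩ := intermediate_value_Icc' (by linarith : t₂ - δ ≤ t₂ + δ)
    (hcont c₁).continuousOn ⟨hc₄.le, hc₃.le⟩
  exact Or.inr (zeroSet_inter_nonempty hn hv0 hu0 (hd₂ _ (mem_image_of_mem _ hv))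
    (hd₁ _ (mem_image_of_mem _ hu)))

lemma zeroSet_eq_empty_of_pos {c : MonIdx n 2 → ℝ}
    (h : ∀ x ∈ Metric.sphere (0 : Fin (n + 1) → ℝ) 1, 0 < mEval c x) : zeroSet c = ∅ := by
  refine eq_empty_of_forall_notMem fun p hp => ?_
  have h0 : ‖p.rep‖ ≠ 0 := norm_ne_zero_iff.2 p.rep_nonzero
  have := h (‖p.rep‖⁻¹ • p.rep) (by simp [norm_smul, h0])
  rw [mEval_smul, show mEval c p.rep = 0 from hp] at this
  simp at this

lemma zeroSet_neg (c : MonIdx n 2 → ℝ) : zeroSet (-c) = zeroSet c := by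
  ext p
  simp [zeroSet, mEval_neg_left]

lemma locallyDominated_of_pos {c : MonIdx n 2 → ℝ}
    (h : ∀ x ∈ Metric.sphere (0 : Fin (n + 1) → ℝ) 1, 0 < mEval c x) : LocallyDominated c :=
  ⟨_, eventually_mEval_pos (isCompact_sphere _ _) h, univ, isOpen_univ, univ_nonempty,
    fun _ hc _ _ => Or.inl (zeroSet_eq_empty_of_pos hc)⟩

lemma locallyDominated_of_neg {c : MonIdx n 2 → ℝ}
    (h : ∀ x ∈ Metric.sphere (0 : Fin (n + 1) → ℝ) 1, mEval c x < 0) : LocallyDominated c :=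
  ⟨_, eventually_mEval_neg (isCompact_sphere _ _) h, univ, isOpen_univ, univ_nonempty,
    fun c₁ hc _ _ => Or.inl (by
      rw [← zeroSet_neg]
      exact zeroSet_eq_empty_of_pos fun x hx => by simpa [mEval_neg_left] using hc x hx)⟩

/-- Coefficients of the positive semidefinite forms which are not positive definite. -/
def degeneratePSD (n : ℕ) : Set (MonIdx n 2 → ℝ) :=
  {c | (∀ x ∈ Metric.sphere (0 : Fin (n + 1) → ℝ) 1, 0 ≤ mEval c x) ∧
    ¬ ∀ x ∈ Metric.sphere (0 : Fin (n + 1) → ℝ) 1, 0 < mEval c x}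

lemma mem_degeneratePSD_of_not_locallyDominated (hn : 2 ≤ n) {c : MonIdx n 2 → ℝ}
    (h : ¬ LocallyDominated c) : c ∈ degeneratePSD n ∨ -c ∈ degeneratePSD n := by
  by_cases hpos : ∃ a, 0 < mEval c a
  · obtain ⟨a, ha⟩ := hpos
    refine Or.inl ⟨fun x _ => ?_, fun h' => h (locallyDominated_of_pos h')⟩
    by_contra! hx
    exact h (locallyDominated_of_indefinite hn ha hx)
  · push Not at hpos
    refine Or.inr ⟨fun x _ => by simpa [mEval_neg_left] using hpos x, fun h' =>
      h (locallyDominated_of_neg fun x hx => by simpa [mEval_neg_left] using h' x hx)⟩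

lemma measurableSet_degeneratePSD (n : ℕ) : MeasurableSet (degeneratePSD n) := by
  have h₁ : IsClosed {c : MonIdx n 2 → ℝ |
      ∀ x ∈ Metric.sphere (0 : Fin (n + 1) → ℝ) 1, 0 ≤ mEval c x} := by
    simp only [ofPred_forall]
    exact isClosed_biInter fun x _ => isClosed_le continuous_const (by fun_prop)
  have h₂ : IsOpen {c : MonIdx n 2 → ℝ |
      ∀ x ∈ Metric.sphere (0 : Fin (n + 1) → ℝ) 1, 0 < mEval c x} :=
    isOpen_iff_mem_nhds.2 fun c hc => eventually_mEval_pos (isCompact_sphere _ _) hc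
  exact h₁.measurableSet.inter h₂.measurableSet.compl

lemma addHaar_degeneratePSD (n : ℕ) (ν : Measure (MonIdx n 2 → ℝ)) [ν.IsAddHaarMeasure] :
    ν (degeneratePSD n) = 0 := by
  obtain ⟨e, he⟩ := exists_mEval_eq_sum_sq n
  have he0 : ∀ x ∈ Metric.sphere (0 : Fin (n + 1) → ℝ) 1, 0 < mEval e x := by
    intro x hx
    obtain ⟨i, hi⟩ : ∃ i, x i ≠ 0 := by
      by_contra! h
      rw [show x = 0 from funext h] at hx
      simp at hx
    rw [he]
    exact Finset.sum_pos' (fun _ _ => sq_nonneg _) ⟨i, Finset.mem_univ _, by positivity⟩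
  have key : ∀ r s : ℝ, r < s → ∀ c ∈ degeneratePSD n, ∀ c' ∈ degeneratePSD n,
      r • e + c ≠ s • e + c' := by
    intro r s hrs c hc c' hc' h
    refine hc.2 fun x hx => ?_
    have h' := congrArg (mEval · x) h
    simp only [mEval_add, mEval_const_smul] at h'
    nlinarith [hc'.1 x hx, he0 x hx, mul_pos (sub_pos.2 hrs) (he0 x hx)]
  refine Measure.addHaar_eq_zero_of_disjoint_translates ν (fun k : ℕ => ((1 / 2 : ℝ) ^ k) • e)
    ?_ ?_ (measurableSet_degeneratePSD n)
  · exact Metric.isBounded_range_of_tendsto _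
      ((tendsto_pow_atTop_nhds_zero_of_lt_one (by norm_num) (by norm_num)).smul_const e)
  · intro k l hkl
    simp only [Function.onFun, singleton_add, disjoint_left]
    rintro _ ⟨c, hc, rfl⟩ ⟨c', hc', h⟩
    have hne : (1 / 2 : ℝ) ^ k ≠ (1 / 2 : ℝ) ^ l := fun h =>
      hkl (pow_right_injective₀ (by norm_num) (by norm_num) h)
    rcases lt_or_gt_of_ne hne with hlt | hlt
    · exact key _ _ hlt c hc c' hc' h.symm
    · exact key _ _ hlt c' hc' c hc h

end Domination

section Kostlan

lemma pi_le_pi {ι : Type*} [Fintype ι] {X : ι → Type*} [∀ i, MeasurableSpace (X i)]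
    {μ ν : ∀ i, Measure (X i)} [∀ i, SigmaFinite (μ i)]
    (h : ∀ i, μ i ≤ ν i) : Measure.pi μ ≤ Measure.pi ν := by
  rw [Measure.le_iff]
  intro s hs
  rw [Measure.pi, Measure.pi, toMeasure_apply _ _ hs, toMeasure_apply _ _ hs]
  refine OuterMeasure.le_pi.2 (fun t ht => ?_) s
  refine (OuterMeasure.pi_pi_le _ _).trans (Finset.prod_le_prod' fun i _ => h i _)

lemma gaussianReal_le_smul_volume (m : ℝ) {v : ℝ≥0} (hv : v ≠ 0) :
    gaussianReal m v ≤ ENNReal.ofReal (√(2 * Real.pi * v))⁻¹ • volume := by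
  rw [gaussianReal_of_var_ne_zero _ hv, ← withDensity_const]
  refine withDensity_mono (ae_of_all _ fun x => ENNReal.ofReal_le_ofReal ?_)
  rw [gaussianPDFReal_def]
  refine mul_le_of_le_one_right (by positivity) (Real.exp_le_one_iff.2 ?_)
  rw [neg_div, neg_nonpos]
  positivity

lemma multinomial_nnreal_ne_zero {n d : ℕ} (α : MonIdx n d) :
    ((Nat.multinomial Finset.univ fun i => (α.1 i : ℕ) : ℕ) : ℝ≥0) ≠ 0 :=
  Nat.cast_ne_zero.2 (Nat.multinomial_pos _ _).ne'

instance isOpenPosMeasure_kostlan (n d : ℕ) : (kostlanMeasure n d).IsOpenPosMeasure := by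
  have : ∀ α : MonIdx n d, (gaussianReal 0
      (Nat.multinomial Finset.univ fun i => (α.1 i : ℕ) : ℕ)).IsOpenPosMeasure := fun α =>
    (gaussianReal_absolutelyContinuous' 0 (multinomial_nnreal_ne_zero α)).isOpenPosMeasure
  unfold kostlanMeasure
  infer_instance

lemma exists_addHaar_ge_kostlan (n d : ℕ) :
    ∃ ν : Measure (MonIdx n d → ℝ), ν.IsAddHaarMeasure ∧ kostlanMeasure n d ≤ ν := by
  let r : MonIdx n d → ℝ≥0∞ := fun α => ENNReal.ofReal
    (√(2 * Real.pi * ((Nat.multinomial Finset.univ fun i => (α.1 i : ℕ) : ℕ) : ℝ≥0)))⁻¹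
  have : ∀ α, (r α • (volume : Measure ℝ)).IsAddHaarMeasure := fun α => by
    refine Measure.IsAddHaarMeasure.smul _ ?_ ENNReal.ofReal_ne_top
    have := pos_iff_ne_zero.2 (multinomial_nnreal_ne_zero α)
    have : (0 : ℝ) < ((Nat.multinomial Finset.univ fun i => (α.1 i : ℕ) : ℕ) : ℝ≥0) := this
    refine (ENNReal.ofReal_pos.2 ?_).ne'
    positivity
  exact ⟨Measure.pi fun α => r α • volume, inferInstance,
    pi_le_pi fun α => gaussianReal_le_smul_volume 0 (multinomial_nnreal_ne_zero α)⟩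

lemma ae_locallyDominated {n : ℕ} (hn : 2 ≤ n) :
    ∀ᵐ c ∂kostlanMeasure n 2, LocallyDominated c := by
  obtain ⟨ν, hν, hle⟩ := exists_addHaar_ge_kostlan n 2
  refine (Measure.absolutelyContinuous_of_le hle).ae_le ?_
  have h₁ : ∀ᵐ c ∂ν, c ∉ degeneratePSD n :=
    measure_eq_zero_iff_ae_notMem.1 (addHaar_degeneratePSD n ν)
  have h₂ : ∀ᵐ c ∂ν, -c ∉ degeneratePSD n :=
    measure_eq_zero_iff_ae_notMem.1
      ((Measure.measure_preimage_neg ν _).trans (addHaar_degeneratePSD n ν))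
  filter_upwards [h₁, h₂] with c hc₁ hc₂
  by_contra h
  exact (mem_degeneratePSD_of_not_locallyDominated hn h).elim hc₁ hc₂

end Kostlan

section Counting

lemma connectedComponents_card_le {X ι : Type*} [TopologicalSpace X] {Z : ι → Set X}
    (hZ : ∀ i, IsPreconnected (Z i)) (T : Finset ι)
    (hT : ∀ i, Z i = ∅ ∨ ∃ j ∈ T, (Z i ∩ Z j).Nonempty) :
    b₀ (⋃ i, Z i : Set X) ≤ T.card := by
  classical
  let T' := {j : T // (Z j).Nonempty}
  let x : T' → (⋃ i, Z i : Set X) := fun j => ⟨j.2.some, mem_iUnion.2 ⟨j.1, j.2.some_mem⟩⟩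
  have hsame : ∀ i, ∀ p q : (⋃ i, Z i : Set X), p.1 ∈ Z i → q.1 ∈ Z i →
      (p : ConnectedComponents (⋃ i, Z i : Set X)) = q := by
    intro i p q hp hq
    have hpre : IsPreconnected ((↑) ⁻¹' Z i : Set (⋃ i, Z i : Set X)) := by
      rw [← Topology.IsInducing.subtypeVal.isPreconnected_image, Subtype.image_preimage_coe,
        inter_eq_right.2 (subset_iUnion Z i)]
      exact hZ i
    exact ConnectedComponents.coe_eq_coe'.2
      (hpre.subset_connectedComponent (x := q) hq hp)
  have hsurj : Function.Surjective
      fun j : T' => (x j : ConnectedComponents (⋃ i, Z i : Set X)) := by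
    intro k
    obtain ⟨p, rfl⟩ := ConnectedComponents.surjective_coe k
    obtain ⟨i, hi⟩ := mem_iUnion.1 p.2
    rcases hT i with h | ⟨j, hj, q, hqi, hqj⟩
    · simp [h] at hi
    · refine ⟨⟨⟨j, hj⟩, ⟨q, hqj⟩⟩, ?_⟩
      exact (hsame j _ ⟨q, mem_iUnion.2 ⟨j, hqj⟩⟩ (Nonempty.some_mem _) hqj).trans
        (hsame i _ _ hqi hi)
  calc b₀ (⋃ i, Z i : Set X) ≤ Nat.card T' := Nat.card_le_card_of_surjective _ hsurj
    _ ≤ Nat.card T := Nat.card_le_card_of_injective _ Subtype.val_injective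
    _ = T.card := by simp

/-- Deterministic bound: `K` hubs, plus the elements outside the hubs' domains, unless some hub
is missing. -/
lemma b₀_le_of_hubs {X C : Type*} [TopologicalSpace X] {Z : C → Set X}
    (hZ : ∀ c, IsPreconnected (Z c)) {U A : ℕ → Set C}
    (hUA : ∀ k, ∀ c ∈ U k, ∀ c' ∈ A k, Z c = ∅ ∨ (Z c ∩ Z c').Nonempty) (K : ℕ) {s : ℕ}
    (ω : Fin s → C) :
    (b₀ (⋃ i, Z (ω i) : Set X) : ℝ) ≤ K + ∑ i, (⋃ k ∈ Finset.range K, U k)ᶜ.indicator 1 (ω i) +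
      s * ∑ k ∈ Finset.range K, {ω : Fin s → C | ∀ i, ω i ∈ (A k)ᶜ}.indicator 1 ω := by
  classical
  have hN : ∀ i, (0 : ℝ) ≤ (⋃ k ∈ Finset.range K, U k)ᶜ.indicator 1 (ω i) := fun i =>
    indicator_nonneg (fun _ _ => zero_le_one) _
  have hM : ∀ k, (0 : ℝ) ≤ {ω : Fin s → C | ∀ i, ω i ∈ (A k)ᶜ}.indicator 1 ω := fun k =>
    indicator_nonneg (fun _ _ => zero_le_one) _
  by_cases h : ∃ k ∈ Finset.range K, ∀ i, ω i ∈ (A k)ᶜ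
  · obtain ⟨k, hk, hi⟩ := h
    have h₁ : b₀ (⋃ i, Z (ω i) : Set X) ≤ s := by
      refine (connectedComponents_card_le (fun i => hZ (ω i)) Finset.univ fun i => ?_).trans
        (by simp)
      rcases (Z (ω i)).eq_empty_or_nonempty with h | h
      · exact Or.inl h
      · exact Or.inr ⟨i, by simp, by simpa using h⟩
    have h₂ : (1 : ℝ) ≤ ∑ k ∈ Finset.range K,
        {ω : Fin s → C | ∀ i, ω i ∈ (A k)ᶜ}.indicator 1 ω :=
      le_trans (indicator_of_mem (s := {ω : Fin s → C | ∀ i, ω i ∈ (A k)ᶜ}) hi 1).ge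
        (Finset.single_le_sum (fun k _ => hM k) hk)
    have h₃ := Finset.sum_nonneg fun i (_ : i ∈ Finset.univ) => hN i
    have h₄ : (b₀ (⋃ i, Z (ω i) : Set X) : ℝ) ≤ s := by exact_mod_cast h₁
    have h₅ := mul_le_mul_of_nonneg_left h₂ (Nat.cast_nonneg (α := ℝ) s)
    have h₆ : (0 : ℝ) ≤ K := Nat.cast_nonneg K
    linarith
  · push Not at h
    choose hub hhub using h
    let R : Finset (Fin s) := {i | ω i ∈ (⋃ k ∈ Finset.range K, U k)ᶜ}
    have hR : (R.card : ℝ) = ∑ i, (⋃ k ∈ Finset.range K, U k)ᶜ.indicator 1 (ω i) := by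
      simp only [R, Finset.card_filter, Nat.cast_sum]
      exact Finset.sum_congr rfl fun i _ => by simp [indicator_apply]
    have h₁ : b₀ (⋃ i, Z (ω i) : Set X) ≤ K + R.card := by
      refine (connectedComponents_card_le (fun i => hZ (ω i))
        ((Finset.range K).attach.image (fun k => hub k.1 k.2) ∪ R) fun i => ?_).trans
        ((Finset.card_union_le _ _).trans ?_)
      · by_cases hi : i ∈ R
        · rcases (Z (ω i)).eq_empty_or_nonempty with h | h
          · exact Or.inl h
          · exact Or.inr ⟨i, Finset.mem_union_right _ hi, by simpa using h⟩
        · obtain ⟨k, hk, hki⟩ : ∃ k ∈ Finset.range K, ω i ∈ U k := by simpa [R] using hi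
          exact (hUA k _ hki _ (not_not.1 (hhub k hk))).imp_right fun h =>
            ⟨hub k hk, Finset.mem_union_left _
              (Finset.mem_image.2 ⟨⟨k, hk⟩, Finset.mem_attach _ _, rfl⟩), h⟩
      · gcongr
        exact Finset.card_image_le.trans (by simp)
    have h₂ : (b₀ (⋃ i, Z (ω i) : Set X) : ℝ) ≤ K + R.card := by exact_mod_cast h₁
    have h₃ := mul_nonneg (Nat.cast_nonneg (α := ℝ) s)
      (Finset.sum_nonneg fun k (_ : k ∈ Finset.range K) => hM k)
    linarith

/-- The expected number of components is sublinear as soon as hubs are available. -/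
lemma tendsto_expected_b₀_div {X C : Type*} [TopologicalSpace X] [MeasurableSpace C]
    {μ : Measure C} [IsProbabilityMeasure μ] {Z : C → Set X} (hZ : ∀ c, IsPreconnected (Z c))
    {U A : ℕ → Set C} (hU : ∀ k, MeasurableSet (U k)) (hA : ∀ k, MeasurableSet (A k))
    (hA0 : ∀ k, μ (A k) ≠ 0) (hcover : μ (⋃ k, U k) = 1)
    (hUA : ∀ k, ∀ c ∈ U k, ∀ c' ∈ A k, Z c = ∅ ∨ (Z c ∩ Z c').Nonempty) :
    Tendsto (fun s : ℕ => (∫ ω : Fin s → C, (b₀ (⋃ i, Z (ω i) : Set X) : ℝ)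
      ∂(Measure.pi fun _ => μ)) / (s : ℝ)) atTop (𝓝 0) := by
  let N : ℕ → Set C := fun K => (⋃ k ∈ Finset.range K, U k)ᶜ
  have hNm : ∀ K, MeasurableSet (N K) := fun K =>
    (Finset.measurableSet_biUnion _ fun k _ => hU k).compl
  have hbound : ∀ K s : ℕ, ∫ ω : Fin s → C, (b₀ (⋃ i, Z (ω i) : Set X) : ℝ)
      ∂(Measure.pi fun _ => μ) ≤
        K + s * μ.real (N K) + s * ∑ k ∈ Finset.range K, μ.real (A k)ᶜ ^ s := by
    intro K s
    have hNi : ∀ i : Fin s, MeasurableSet {ω : Fin s → C | ω i ∈ N K} := fun i =>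
      measurable_pi_apply i (hNm K)
    have hMk : ∀ k, MeasurableSet {ω : Fin s → C | ∀ i, ω i ∈ (A k)ᶜ} := fun k => by
      simp only [ofPred_forall]
      exact MeasurableSet.iInter fun i => measurable_pi_apply i (hA k).compl
    have hI₁ : ∀ i : Fin s, Integrable (fun ω : Fin s → C => (N K).indicator (1 : C → ℝ) (ω i))
        (Measure.pi fun _ => μ) := fun i =>
      (integrable_const (1 : ℝ)).indicator (hNi i)
    have hI₂ : ∀ k, Integrable
        ({ω : Fin s → C | ∀ i, ω i ∈ (A k)ᶜ}.indicator (1 : (Fin s → C) → ℝ))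
        (Measure.pi fun _ => μ) := fun k =>
      (integrable_const (1 : ℝ)).indicator (hMk k)
    have hE₁ : ∀ i : Fin s, ∫ ω : Fin s → C, (N K).indicator (1 : C → ℝ) (ω i)
        ∂(Measure.pi fun _ => μ) = μ.real (N K) := fun i => by
      refine (integral_indicator_one (hNi i)).trans ?_
      rw [Measure.real, Measure.real]
      exact congrArg ENNReal.toReal ((measurePreserving_eval (fun _ : Fin s => μ) i).measure_preimage
        (hNm K).nullMeasurableSet)
    have hE₂ : ∀ k, ∫ ω, {ω : Fin s → C | ∀ i, ω i ∈ (A k)ᶜ}.indicator (1 : (Fin s → C) → ℝ) ω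
        ∂(Measure.pi fun _ => μ) = μ.real (A k)ᶜ ^ s := fun k => by
      rw [integral_indicator_one (hMk k)]
      have : {ω : Fin s → C | ∀ i, ω i ∈ (A k)ᶜ} = univ.pi fun _ => (A k)ᶜ := by
        ext; simp
      rw [this, Measure.real, Measure.pi_pi]
      simp [Measure.real]
    have hS₁ := integrable_finsetSum Finset.univ fun i _ => hI₁ i
    have hS₂ := integrable_finsetSum (Finset.range K) fun k _ => hI₂ k
    refine (integral_mono_of_nonneg (ae_of_all _ fun ω => Nat.cast_nonneg _)
      (((integrable_const (K : ℝ)).add hS₁).add (hS₂.const_mul (s : ℝ)))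
      (ae_of_all _ fun ω => b₀_le_of_hubs hZ hUA K ω)).trans_eq ?_
    rw [integral_add' ((integrable_const (K : ℝ)).add hS₁) (hS₂.const_mul (s : ℝ)),
      integral_add' (integrable_const (K : ℝ)) hS₁, integral_const_mul,
      integral_finsetSum _ fun i _ => hI₁ i, integral_finsetSum _ fun k _ => hI₂ k]
    simp only [hE₁, hE₂]
    simp
  have hNlim : Tendsto (fun K => μ.real (N K)) atTop (𝓝 0) := by
    have hanti : Antitone N := fun K L hKL => compl_subset_compl.2
      (biUnion_subset_biUnion_left fun k hk =>
        Finset.mem_range.2 ((Finset.mem_range.1 hk).trans_le hKL))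
    have h := tendsto_measure_iInter_atTop (μ := μ) (fun K => (hNm K).nullMeasurableSet) hanti
      ⟨0, measure_ne_top _ _⟩
    have hinter : ⋂ K, N K = (⋃ k, U k)ᶜ := by
      ext c
      simp only [N, mem_iInter, mem_compl_iff, mem_iUnion, Finset.mem_range, not_exists]
      exact ⟨fun h k => h (k + 1) k (Nat.lt_succ_self k), fun h _ k _ => h k⟩
    rw [hinter, (prob_compl_eq_zero_iff (MeasurableSet.iUnion hU)).2 hcover] at h
    simpa [Function.comp_def, Measure.real] using
      (ENNReal.tendsto_toReal ENNReal.zero_ne_top).comp h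
  have hq : ∀ k, Tendsto (fun s : ℕ => μ.real (A k)ᶜ ^ s) atTop (𝓝 0) := fun k => by
    refine tendsto_pow_atTop_nhds_zero_of_lt_one measureReal_nonneg ?_
    rw [probReal_compl_eq_one_sub (hA k)]
    have := (measureReal_ne_zero_iff (μ := μ) (s := A k)).2 (hA0 k)
    have := lt_of_le_of_ne measureReal_nonneg this.symm
    linarith
  have hnonneg : ∀ s : ℕ, 0 ≤ (∫ ω : Fin s → C, (b₀ (⋃ i, Z (ω i) : Set X) : ℝ)
      ∂(Measure.pi fun _ => μ)) / (s : ℝ) := fun s =>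
    div_nonneg (integral_nonneg fun _ => Nat.cast_nonneg _) (Nat.cast_nonneg _)
  rw [Metric.tendsto_atTop']
  intro ε hε
  obtain ⟨K, hK⟩ := (hNlim.eventually (gt_mem_nhds hε)).exists
  have hlim : Tendsto (fun s : ℕ => (K : ℝ) / s + μ.real (N K) +
      ∑ k ∈ Finset.range K, μ.real (A k)ᶜ ^ s) atTop (𝓝 (μ.real (N K))) := by
    simpa using ((tendsto_const_div_atTop_nhds_zero_nat (K : ℝ)).add_const (μ.real (N K))).add
      (tendsto_finsetSum (Finset.range K) fun k _ => hq k)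
  obtain ⟨s₀, hs₀⟩ := eventually_atTop.1 ((hlim.eventually (gt_mem_nhds hK)).and
    (eventually_gt_atTop 0))
  refine ⟨s₀, fun s hs => ?_⟩
  obtain ⟨hlt, hspos⟩ := hs₀ s hs.le
  rw [Real.dist_eq, sub_zero, abs_of_nonneg (hnonneg s)]
  refine lt_of_le_of_lt ?_ hlt
  have hs' : (0 : ℝ) < s := by exact_mod_cast hspos
  rw [div_le_iff₀ hs']
  refine (hbound K s).trans_eq ?_
  field_simp

end Counting

lemma exists_seq_hubs {n : ℕ} (hn : 2 ≤ n) :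
    ∃ U A : ℕ → Set (MonIdx n 2 → ℝ), (∀ k, IsOpen (U k)) ∧ (∀ k, IsOpen (A k)) ∧
      (∀ k, (A k).Nonempty) ∧ kostlanMeasure n 2 (⋃ k, U k) = 1 ∧
      ∀ k, ∀ c ∈ U k, ∀ c' ∈ A k, zeroSet c = ∅ ∨ (zeroSet c ∩ zeroSet c').Nonempty := by
  have hae := ae_locallyDominated hn
  choose! U hU A hA hne hUA using fun (c : MonIdx n 2 → ℝ) (h : LocallyDominated c) => h
  obtain ⟨t, ht, htc, hcov⟩ := TopologicalSpace.countable_cover_nhdsWithin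
    (s := {c : MonIdx n 2 → ℝ | LocallyDominated c}) (f := fun c => interior (U c))
    fun c hc => mem_nhdsWithin_of_mem_nhds (interior_mem_nhds.2 (hU c hc))
  obtain ⟨c₀, hc₀⟩ := hae.exists
  have htne : t.Nonempty := by
    obtain ⟨c, hc, -⟩ := mem_iUnion₂.1 (hcov hc₀)
    exact ⟨c, hc⟩
  obtain ⟨f, rfl⟩ := htc.exists_eq_range htne
  have hf : ∀ k, LocallyDominated (f k) := fun k => ht (mem_range_self k)
  refine ⟨fun k => interior (U (f k)), fun k => A (f k), fun _ => isOpen_interior,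
    fun k => hA _ (hf k), fun k => hne _ (hf k), ?_, fun k c hc =>
      hUA _ (hf k) c (interior_subset hc)⟩
  rw [← mem_ae_iff_prob_eq_one (MeasurableSet.iUnion fun k => isOpen_interior.measurableSet)]
  filter_upwards [hae] with c hc
  simpa using hcov hc

/-- Fix `n ≥ 2`. For each `s ≥ 1`, let `P_1, …, P_s` be independent Kostlan random
homogeneous polynomials of degree `2` in `n+1` variables, and let
`Γ_s = Z(P_1) ∪ ⋯ ∪ Z(P_s) ⊆ ℝP^n`. Then `E[b₀(Γ_s)]/s → 0` as `s → ∞`. -/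
theorem random_quadric_arrangement_b0 (n : ℕ) (hn : 2 ≤ n) :
    Filter.Tendsto
      (fun s : ℕ =>
        (∫ ω : Fin s → (MonIdx n 2 → ℝ),
            (b₀ ((⋃ i, zeroSet (ω i)) : Set (Projectivization ℝ (Fin (n + 1) → ℝ))) : ℝ)
            ∂(Measure.pi fun _ => kostlanMeasure n 2)) / (s : ℝ))
      Filter.atTop (nhds 0) := by
  obtain ⟨U, A, hU, hA, hne, hcover, hUA⟩ := exists_seq_hubs hn
  exact tendsto_expected_b₀_div (isPreconnected_zeroSet hn) (fun k => (hU k).measurableSet)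
    (fun k => (hA k).measurableSet) (fun k => ((hA k).measure_pos _ (hne k)).ne') hcover hUA
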